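/- Every G-invariant unital subalgebra of a G-simple algebra A = End_D(V) is symmetrically embedded in A: it is semisimple with all simple components isomorphic, and its centralizer in A is also a direct sum of mutually isomorphic simple algebras. -/

import Mathlib

universe u
set_option synthInstance.maxHeartbeats 1000000
set_option maxHeartbeats 1000000

/-- An automorphism of a finite product of simple algebras maps the `i`-th identity to an element
with vanishing `j`-th component, unless the `i`-th and `j`-th factors are isomorphic. -/
theorem aux_component {F : Type*} [Field F] {n : ℕ} (R : Fin n → Type*) [∀ i, Ring (R i)]
    [∀ i, Algebra F (R i)] [∀ i, IsSimpleRing (R i)]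
    (σ : (∀ i, R i) ≃ₐ[F] (∀ i, R i)) (i j : Fin n)
    (h : σ (Pi.single i 1) j ≠ 0) : Nonempty (R i ≃ₐ[F] R j) := by
  set c := σ (Pi.single i 1) j with hc
  have hcomm : ∀ z : (∀ i, R i), Pi.single i 1 * z = z * Pi.single i (1 : R i) := by
    intro z
    ext k
    by_cases hk : k = i
    · subst hk; simp
    · simp [hk]
  have hsingle : ∀ z : (∀ i, R i), Pi.single i 1 * z = Pi.single i (z i) := by
    intro z
    ext k
    by_cases hk : k = i
    · subst hk; simp
    · simp [hk]
  have hcen : ∀ y : R j, c * y = y * c := by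
    intro y
    have := congrArg (fun z => σ z j) (hcomm (σ.symm (Pi.single j y)))
    simpa [map_mul] using this
  have hidem : c * c = c := by
    have h1 : (Pi.single i (1 : R i) : ∀ i, R i) * Pi.single i 1 = Pi.single i 1 := by
      rw [hsingle]; simp
    have := congrArg (fun z => σ z j) h1
    simpa [map_mul] using this
  have hc1 : c = 1 := by
    have hf := IsSimpleRing.isField_center (R j)
    let c' : Subring.center (R j) := ⟨c, Subring.mem_center_iff.2 fun y => (hcen y).symm⟩
    obtain ⟨d, hd⟩ := hf.mul_inv_cancel (a := c') (fun h0 => h (congrArg Subtype.val h0))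
    have hd' : c * d.1 = 1 := congrArg Subtype.val hd
    calc c = c * (c * d.1) := by rw [hd', mul_one]
      _ = 1 := by rw [← mul_assoc, hidem, hd']
  let f : R i →ₐ[F] R j :=
    AlgHom.ofLinearMap
      ((LinearMap.proj j : (∀ i, R i) →ₗ[F] R j) ∘ₗ σ.toLinearMap ∘ₗ LinearMap.single F R i)
      (by simpa [hc] using hc1)
      (by
        intro x y
        have h1 : (Pi.single i (x * y) : ∀ i, R i) = Pi.single i x * Pi.single i y :=
          Pi.single_mul i x y
        simp [h1])
  have hfx : ∀ x, f x = σ (Pi.single i x) j := fun x => rfl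
  refine ⟨AlgEquiv.ofBijective f ⟨f.toRingHom.injective, fun y => ?_⟩⟩
  refine ⟨σ.symm (Pi.single j y) i, ?_⟩
  rw [hfx, ← hsingle, map_mul, Pi.mul_apply, ← hc, hc1]
  simp

theorem aux_main
    {F : Type u} [Field F] {D : Type u} [DivisionRing D] [Algebra F D]
    {V : Type u} [AddCommGroup V] [Module D V] [Module F V]
    [IsScalarTower F D V] [SMulCommClass D F V] [FiniteDimensional F V]
    {G : Type*} (ρ : G → V ≃ₗ[D] V)
    (hirr : ∀ L : Submodule F V, (∀ g : G, ∀ v ∈ L, ρ g v ∈ L) → L = ⊥ ∨ L = ⊤)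
    (B : Subalgebra F (Module.End D V))
    (hB : ∀ g : G, ∀ f ∈ B, ((ρ g : V →ₗ[D] V) * f * ((ρ g).symm : V →ₗ[D] V)) ∈ B) :
    IsSemisimpleRing ↥B ∧
    (∃ (l : ℕ) (S : Type u) (_ : Ring S) (_ : Algebra F S),
      IsSimpleRing S ∧ Nonempty (↥B ≃ₐ[F] (Fin l → S))) := by
  have hρF : ∀ g (a : F) v, ρ g (a • v) = a • ρ g v := by
    intro g a v
    rw [← algebraMap_smul D a v, map_smul, algebraMap_smul]
  haveI hfin : FiniteDimensional F (Module.End D V) :=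
    FiniteDimensional.of_injective (LinearMap.restrictScalarsₗ F D V V F)
      (LinearMap.restrictScalars_injective F)
  haveI hfinB : FiniteDimensional F B := inferInstance
  haveI hart : IsArtinianRing B := IsArtinianRing.of_finite F B
  -- conjugation automorphisms
  have hσ : ∀ g : G, ∃ σ : B ≃ₐ[F] B, ∀ (b : B) (v : V), (σ b).1 (ρ g v) = ρ g (b.1 v) := by
    intro g
    let τ : B →ₐ[F] B := AlgHom.ofLinearMap
      { toFun := fun b => ⟨_, hB g b.1 b.2⟩
        map_add' := by
          intro x y; apply Subtype.ext; ext v; simp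
        map_smul' := by
          intro a x; apply Subtype.ext; ext v; simp [hρF] }
      (by apply Subtype.ext; ext v; simp)
      (by intro x y; apply Subtype.ext; ext v; simp)
    have hτ : ∀ (b : B) (v : V), (τ b).1 (ρ g v) = ρ g (b.1 v) := by
      intro b v
      change ρ g (b.1 ((ρ g).symm (ρ g v))) = _
      simp
    have hinj : Function.Injective τ := by
      intro x y hxy
      apply Subtype.ext; ext v
      apply (ρ g).injective
      rw [← hτ, ← hτ, hxy]
    have hsurj : Function.Surjective τ :=
      (LinearMap.injective_iff_surjective (f := τ.toLinearMap)).1 hinj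
    exact ⟨AlgEquiv.ofBijective τ ⟨hinj, hsurj⟩, hτ⟩
  choose σ hσ using hσ
  have hss : IsSemisimpleRing B := by
    rw [IsArtinianRing.isSemisimpleRing_iff_jacobson]
    let K : Submodule F V :=
      { carrier := {v | ∀ j ∈ Ring.jacobson B, j.1 v = 0}
        zero_mem' := by intro j _; simp
        add_mem' := by
          intro a b ha hb j hj
          rw [map_add, ha j hj, hb j hj, add_zero]
        smul_mem' := by
          intro a v hv j hj
          rw [← algebraMap_smul D a v, map_smul, hv j hj, smul_zero] }
    have hK := hirr K (by
      intro g v hv j hj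
      have h1 : (σ g).symm j ∈ Ring.jacobson B :=
        Ring.le_comap_jacobson ((σ g).symm.toRingEquiv : B →+* B) hj
      have h2 := hσ g ((σ g).symm j) v
      rw [AlgEquiv.apply_symm_apply] at h2
      rw [h2, hv _ h1, map_zero])
    have hall : ∀ v : V, v ∈ K := by
      rcases hK with hK | hK
      · obtain ⟨n, hn⟩ := IsSemiprimaryRing.isNilpotent (R := B)
        have key : ∀ k : ℕ, ∀ v : V, (∀ j ∈ Ring.jacobson B ^ k, j.1 v = 0) → v = 0 := by
          intro k
          induction k with
          | zero =>
            intro v hv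
            simpa using hv 1 (by rw [Submodule.pow_zero]; simp)
          | succ k ih =>
            intro v hv
            apply ih
            intro a ha
            have : a.1 v ∈ K := by
              intro j hj
              exact hv (j * a) (by rw [Ideal.IsTwoSided.pow_succ]; exact Ideal.mul_mem_mul hj ha)
            rw [hK] at this
            simpa using this
        intro v
        have : v = 0 := key n v (by
          intro j hj
          rw [hn] at hj
          have : j = 0 := by simpa using hj
          rw [this]; rfl)
        rw [this]; exact K.zero_mem
      · intro v; rw [hK]; trivial
    rw [eq_bot_iff]
    intro j hj
    have : j = 0 := by
      apply Subtype.ext; ext v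
      exact hall v j hj
    simp [this]
  refine ⟨hss, ?_⟩
  obtain ⟨n, D', d, _, _, hd, ⟨e⟩⟩ :=
    IsSemisimpleRing.exists_algEquiv_pi_matrix_divisionRing F B
  let R : Fin n → Type u := fun i => Matrix (Fin (d i)) (Fin (d i)) (D' i)
  haveI hsimp : ∀ i, IsSimpleRing (R i) := fun i => by
    haveI := hd i
    exact IsSimpleRing.matrix _ _
  replace e : B ≃ₐ[F] (∀ i, R i) := e
  rcases Nat.eq_zero_or_pos n with hn | hn
  · subst hn
    exact ⟨0, F, inferInstance, inferInstance, inferInstance,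
      ⟨e.trans (AlgEquiv.ofRingEquiv (f :=
        { toFun := fun _ i => i.elim0, invFun := fun _ i => i.elim0
          left_inv := fun _ => funext fun i => i.elim0
          right_inv := fun _ => funext fun i => i.elim0
          map_mul' := fun _ _ => funext fun i => i.elim0
          map_add' := fun _ _ => funext fun i => i.elim0 })
        (fun _ => funext fun i => i.elim0))⟩⟩
  let i0 : Fin n := ⟨0, hn⟩
  classical
  let E : ∀ i, R i := fun i => if Nonempty (R i ≃ₐ[F] R i0) then 1 else 0
  have hE : ∀ τ : (∀ i, R i) ≃ₐ[F] (∀ i, R i), E * τ E = τ E := by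
    intro τ
    funext j
    by_cases hj : Nonempty (R j ≃ₐ[F] R i0)
    · simp [E, hj]
    · have hsum : E = ∑ i, Pi.single i (E i) := (Finset.univ_sum_single E).symm
      have h0 : τ E j = 0 := by
        rw [hsum, map_sum, Finset.sum_apply]
        apply Finset.sum_eq_zero
        intro i _
        by_cases hi : Nonempty (R i ≃ₐ[F] R i0)
        · have hEi : E i = 1 := if_pos hi
          rw [hEi]
          by_contra hne
          obtain ⟨f⟩ := aux_component R τ i j hne
          exact hj ⟨f.symm.trans hi.some⟩
        · have hEi : E i = 0 := if_neg hi
          rw [hEi]; simp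
      rw [Pi.mul_apply, h0, mul_zero]
  let ε : B := e.symm E
  have hε : ∀ g, ε * σ g ε = σ g ε := by
    intro g
    have := hE ((e.symm.trans (σ g)).trans e)
    apply e.injective
    simpa [ε] using this
  have hεε : ε * ε = ε := by
    have h1 := hE AlgEquiv.refl
    apply e.injective
    simpa [ε] using h1
  have hE0 : E i0 = 1 := if_pos ⟨AlgEquiv.refl⟩
  let L : Submodule F V :=
    { carrier := {v | ε.1 v = v}
      zero_mem' := by simp
      add_mem' := by
        intro a b ha hb
        change ε.1 (a + b) = a + b
        rw [map_add, ha, hb]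
      smul_mem' := by
        intro a v hv
        change ε.1 (a • v) = a • v
        rw [← algebraMap_smul D a v, map_smul, hv] }
  have hL := hirr L (by
    intro g v hv
    change ε.1 (ρ g v) = ρ g v
    have h1 : (σ g ε).1 (ρ g v) = ρ g v := by rw [hσ]; rw [show ε.1 v = v from hv]
    have h2 : ε.1 ((σ g ε).1 (ρ g v)) = (σ g ε).1 (ρ g v) :=
      congrArg (fun b : B => b.1 (ρ g v)) (hε g)
    rwa [h1] at h2)
  have hε1 : ε = 1 := by
    rcases hL with hL | hL
    · exfalso
      have : ε = 0 := by
        apply Subtype.ext; ext v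
        have h1 : ε.1 v ∈ L := congrArg (fun b : B => b.1 v) hεε
        rw [hL] at h1
        simpa using h1
      have h2 : E = 0 := by
        have := congrArg e this
        simpa [ε] using this
      rw [h2] at hE0
      exact zero_ne_one hE0
    · apply Subtype.ext; ext v
      have h1 : v ∈ L := by rw [hL]; trivial
      exact h1
  have hE1 : E = 1 := by
    have := congrArg e hε1
    simpa [ε] using this
  have hiso : ∀ i, Nonempty (R i ≃ₐ[F] R i0) := by
    intro i
    by_contra hi
    have h1 : E i = 0 := if_neg hi
    rw [hE1] at h1
    exact one_ne_zero h1
  exact ⟨n, R i0, inferInstance, inferInstance, hsimp i0,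
    ⟨e.trans (AlgEquiv.piCongrRight fun i => (hiso i).some)⟩⟩

/-- Every `G`-invariant unital subalgebra `B` of a `G`-simple algebra
`A = End_D(V)` is symmetrically embedded in `A`: it is semisimple with all its simple
components isomorphic (`B ≅ S^l` for a simple `F`-algebra `S`), and its centralizer in `A`
is likewise a direct sum of mutually isomorphic simple `F`-algebras. -/
theorem invariant_subalgebra_symmetrically_embedded
    {F : Type u} [Field F] {D : Type u} [DivisionRing D] [Algebra F D]
    {V : Type u} [AddCommGroup V] [Module D V] [Module F V]
    [IsScalarTower F D V] [SMulCommClass D F V] [FiniteDimensional F V]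
    {G : Type*} [Group G]
    (ρ : G → V ≃ₗ[D] V) (α : G → G → Fˣ)
    (hρ1 : ρ 1 = LinearEquiv.refl D V)
    (hcoc : ∀ x y : G, ∀ v : V, ρ (x * y) v = (α x y : F) • ρ x (ρ y v))
    (hirr : ∀ L : Submodule F V, (∀ g : G, ∀ v ∈ L, ρ g v ∈ L) → L = ⊥ ∨ L = ⊤)
    (B : Subalgebra F (Module.End D V))
    (hB : ∀ g : G, ∀ f ∈ B, ((ρ g : V →ₗ[D] V) * f * ((ρ g).symm : V →ₗ[D] V)) ∈ B) :
    IsSemisimpleRing ↥B ∧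
    (∃ (l : ℕ) (S : Type u) (_ : Ring S) (_ : Algebra F S),
      IsSimpleRing S ∧ Nonempty (↥B ≃ₐ[F] (Fin l → S))) ∧
    (∃ (l : ℕ) (S : Type u) (_ : Ring S) (_ : Algebra F S),
      IsSimpleRing S ∧
      Nonempty (↥(Subalgebra.centralizer F (B : Set (Module.End D V))) ≃ₐ[F] (Fin l → S))) := by
  obtain ⟨h1, h2⟩ := aux_main ρ hirr B hB
  refine ⟨h1, h2, (aux_main ρ hirr (Subalgebra.centralizer F (B : Set (Module.End D V))) ?_).2⟩
  -- the centralizer of an invariant subalgebra is invariant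
  have hρF : ∀ g (a : F) v, ρ g (a • v) = a • ρ g v := by
    intro g a v
    rw [← algebraMap_smul D a v, map_smul, algebraMap_smul]
  have hinv : ∀ g : G, ∀ f ∈ B,
      (((ρ g).symm : V →ₗ[D] V) * f * (ρ g : V →ₗ[D] V)) ∈ B := by
    intro g f hf
    have ha : (α g⁻¹ g : F) ≠ 0 := (α g⁻¹ g).ne_zero
    have e1 : ∀ v, (α g⁻¹ g : F) • ρ g⁻¹ (ρ g v) = v := by
      intro v
      rw [← hcoc, inv_mul_cancel, hρ1]
      rfl
    have e2 : ∀ v, (ρ g).symm v = (α g⁻¹ g : F) • ρ g⁻¹ v := by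
      intro v
      have := e1 ((ρ g).symm v)
      rw [LinearEquiv.apply_symm_apply] at this
      exact this.symm
    have e3 : ∀ v, (ρ g⁻¹).symm v = (α g⁻¹ g : F) • ρ g v := by
      intro v
      rw [LinearEquiv.symm_apply_eq, hρF, e1]
    have h3 := hB g⁻¹ f hf
    convert h3 using 1
    ext v
    change (ρ g).symm (f (ρ g v)) = ρ g⁻¹ (f ((ρ g⁻¹).symm v))
    rw [e2, e3, ← algebraMap_smul D _ (ρ g v), map_smul, algebraMap_smul, hρF]
  intro g c hc
  rw [Subalgebra.mem_centralizer_iff] at hc ⊢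
  intro b hb
  have h3 := hc _ (hinv g b hb)
  ext v
  have h4 := congrArg (fun f : Module.End D V => ρ g (f ((ρ g).symm v))) h3
  simpa using h4
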